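/- arXiv:2601.03653 — 2 statements merged into one kernel-verified Lean document; each statement's English description precedes it below -/
import Mathlib

section
/- Let q be a prime power, m ≤ n positive integers, and C ⊆ Mat_{m×n}(F_q) a rank-metric code with minimum distance d = min{rank(X−Y) : X,Y ∈ C, X ≠ Y}. Then |C| ≤ q^{n(m−d+1)}. -/
theorem rank_le_of_rows_zero {F : Type} [Field F] {m n k : ℕ}
    (A : Matrix (Fin m) (Fin n) F) (hA : ∀ i : Fin m, i.val < k → A i = 0) :
    A.rank ≤ m - k := by
  classical
  rw [Matrix.rank_eq_finrank_span_row]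
  let S : Finset (Fin m) := Finset.univ.filter (fun i => k ≤ i.val)
  have hS : S.card ≤ m - k := by
    have h1 : (S.map Fin.valEmbedding) ⊆ Finset.Ico k m := by
      intro x hx
      simp only [S, Finset.mem_map, Finset.mem_filter, Finset.mem_univ, true_and] at hx
      obtain ⟨i, hi, rfl⟩ := hx
      simp only [Finset.mem_Ico, Fin.valEmbedding_apply]
      exact ⟨hi, i.isLt⟩
    simpa using Finset.card_le_card h1
  have hle : Submodule.span F (Set.range A.row) ≤
      Submodule.span F ((S.image A.row : Finset (Fin n → F)) : Set (Fin n → F)) := by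
    rw [Submodule.span_le]
    rintro _ ⟨i, rfl⟩
    by_cases hi : i.val < k
    · have h0 : A.row i = 0 := hA i hi
      rw [h0]
      exact Submodule.zero_mem _
    · apply Submodule.subset_span
      simp only [Finset.coe_image]
      exact ⟨i, by simpa [S] using hi, rfl⟩
  calc _ ≤ _ := Submodule.finrank_mono hle
    _ ≤ (S.image A.row).card := finrank_span_finset_le_card _
    _ ≤ S.card := Finset.card_image_le
    _ ≤ m - k := hS

/-- **Singleton-type bound for rank-metric codes.**
Let `C ⊆ Mat_{m×n}(F_q)` (with `m ≤ n`) be a rank-metric code with at least two codewords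
and minimum distance `d = min { rank (X - Y) | X, Y ∈ C, X ≠ Y }`.
Then `|C| ≤ q ^ (n * (m - d + 1))`. -/
theorem singleton_bound_rank_metric
    {F : Type} [Field F] [Fintype F] {q m n d : ℕ}
    (hq : Fintype.card F = q)
    (hm : 0 < m) (hmn : m ≤ n)
    (C : Finset (Matrix (Fin m) (Fin n) F))
    (hd_le : ∀ X ∈ C, ∀ Y ∈ C, X ≠ Y → d ≤ (X - Y).rank)
    (hd_eq : ∃ X ∈ C, ∃ Y ∈ C, X ≠ Y ∧ (X - Y).rank = d) :
    C.card ≤ q ^ (n * (m - d + 1)) := by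
  classical
  obtain ⟨X₀, -, Y₀, -, hne, hr⟩ := hd_eq
  have hdm : d ≤ m := by
    rw [← hr]
    simpa using (X₀ - Y₀).rank_le_height
  have hd0 : 0 < d := by
    rw [← hr]
    refine Nat.pos_of_ne_zero fun h => hne ?_
    rw [Matrix.rank_eq_finrank_span_row, Submodule.finrank_eq_zero, Submodule.span_eq_bot] at h
    refine sub_eq_zero.mp ?_
    funext i
    exact h _ ⟨i, rfl⟩
  have hk : m - d + 1 ≤ m := by omega
  let f : Matrix (Fin m) (Fin n) F → (Fin (m - d + 1) → Fin n → F) :=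
    fun X i => X (Fin.castLE hk i)
  have hinj : Set.InjOn f C := by
    intro X hX Y hY hXY
    by_contra hne'
    have h1 := hd_le X hX Y hY hne'
    have h2 : (X - Y).rank ≤ m - (m - d + 1) := by
      apply rank_le_of_rows_zero
      intro i hi
      have h3 := congrFun hXY ⟨i.val, hi⟩
      exact sub_eq_zero.mpr h3
    omega
  calc C.card = (C.image f).card := (Finset.card_image_of_injOn hinj).symm
    _ ≤ Fintype.card (Fin (m - d + 1) → Fin n → F) := Finset.card_le_univ _
    _ = q ^ (n * (m - d + 1)) := by simp [hq, pow_mul]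
end

section
/- With n = lcm(ℓ,s), g = gcd(ℓ,s), Δ = k(τ) the division algebra over K = F_q(π) as above, and Δ(ℓ,s) = F_{q^ℓ}(τ^s), Δ(s,ℓ) = F_{q^s}(τ^ℓ): the centralizer of Δ(ℓ,s) in Δ equals Δ(s,ℓ), and dim_{K_g} Δ(ℓ,s) = (ℓ/g)² where K_g = F_{q^g}(π). -/
/-- conjugation by a nonzero element -/
def cjHom {Δ : Type} [DivisionRing Δ] (u : Δ) (hu : u ≠ 0) : Δ →+* Δ where
  toFun x := u * x * u⁻¹
  map_one' := by simp [hu]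
  map_mul' x y := by
    have : u⁻¹ * u = 1 := inv_mul_cancel₀ hu
    calc u * (x * y) * u⁻¹ = u * x * 1 * y * u⁻¹ := by simp [mul_assoc]
      _ = u * x * (u⁻¹ * u) * y * u⁻¹ := by rw [this]
      _ = _ := by simp only [mul_assoc]
  map_zero' := by simp
  map_add' x y := by simp [mul_add, add_mul]

theorem aux_comm_closure {Δ : Type} [DivisionRing Δ] {A B : Set Δ}
    (h : ∀ a ∈ A, ∀ b ∈ B, a * b = b * a) :
    ∀ a ∈ Subfield.closure A, ∀ b ∈ Subfield.closure B, a * b = b * a := by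
  have key : ∀ (A : Set Δ) (b : Δ), (∀ a ∈ A, Commute a b) →
      ∀ a ∈ Subfield.closure A, Commute a b := by
    intro A b h a ha
    induction ha using Subfield.closure_induction with
    | mem x hx => exact h x hx
    | one => exact Commute.one_left b
    | add x y _ _ hx hy => exact hx.add_left hy
    | neg x _ hx => exact hx.neg_left
    | inv x _ hx => exact hx.inv_left₀
    | mul x y _ _ hx hy => exact hx.mul_left hy
  intro a ha b hb
  refine key A b ?_ a ha
  intro a ha
  exact (key B a (fun b hb => (h a ha b hb).symm) b hb).symm

theorem aux_conj_closure {Δ : Type} [DivisionRing Δ] {A : Set Δ} (u : Δ) (hu : u ≠ 0)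
    (h : ∀ a ∈ A, u * a * u⁻¹ ∈ Subfield.closure A) :
    ∀ a ∈ Subfield.closure A, u * a * u⁻¹ ∈ Subfield.closure A := by
  have : Subfield.closure A ≤ (Subfield.closure A).comap (cjHom u hu) :=
    Subfield.closure_le.2 fun a ha => h a ha
  intro a ha
  exact this ha

/-- `M[T]` is a division ring when it is finite over `M`. -/
theorem aux_span {Δ : Type} [DivisionRing Δ] (M : Subfield Δ) (T : Δ) (d : ℕ) (hd : 0 < d)
    (hT : ∀ m ∈ M, ∃ m' ∈ M, T * m = m' * T)
    (hTd : T ^ d ∈ Submodule.span M (Set.range fun i : Fin d => T ^ (i : ℕ))) :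
    ∀ x ∈ Subfield.closure ((M : Set Δ) ∪ {T}),
      x ∈ Submodule.span M (Set.range fun i : Fin d => T ^ (i : ℕ)) := by
  set S := Submodule.span M (Set.range fun i : Fin d => T ^ (i : ℕ)) with hS
  have hone : (1 : Δ) ∈ S := Submodule.subset_span ⟨⟨0, hd⟩, by simp⟩
  have hTS : ∀ y ∈ S, T * y ∈ S := by
    intro y hy
    induction hy using Submodule.span_induction with
    | mem x hx =>
      obtain ⟨i, rfl⟩ := hx
      by_cases hi : (i : ℕ) + 1 < d
      · exact Submodule.subset_span ⟨⟨i + 1, hi⟩, by simp [pow_succ']⟩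
      · have : (i : ℕ) + 1 = d := by omega
        change T * T ^ (i : ℕ) ∈ S
        rw [← pow_succ', this]; exact hTd
    | zero => simp
    | add x y _ _ hx hy => rw [mul_add]; exact S.add_mem hx hy
    | smul a x _ hx =>
      obtain ⟨m', hm', e⟩ := hT a a.2
      have : T * (a • x) = (⟨m', hm'⟩ : M) • (T * x) := by
        change T * ((a : Δ) * x) = m' * (T * x)
        rw [← mul_assoc, e, mul_assoc]
      rw [this]; exact S.smul_mem _ hx
  have hTp : ∀ (i : ℕ), ∀ y ∈ S, T ^ i * y ∈ S := by
    intro i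
    induction i with
    | zero => intro y hy; simpa using hy
    | succ i ih => intro y hy; rw [pow_succ', mul_assoc]; exact hTS _ (ih y hy)
  have hmul : ∀ x ∈ S, ∀ y ∈ S, x * y ∈ S := by
    intro x hx y hy
    induction hx using Submodule.span_induction with
    | mem x hx => obtain ⟨i, rfl⟩ := hx; exact hTp i y hy
    | zero => simp
    | add a b _ _ ha hb => rw [add_mul]; exact S.add_mem ha hb
    | smul a x _ hx => rw [smul_mul_assoc]; exact S.smul_mem _ hx
  have : FiniteDimensional M S := FiniteDimensional.span_of_finite M (Set.finite_range _)
  have hinv : ∀ x ∈ S, x⁻¹ ∈ S := by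
    intro x hx
    by_cases h0 : x = 0
    · simp [h0]
    let f : S →ₗ[M] S :=
      { toFun := fun y => ⟨y.1 * x, hmul _ y.2 _ hx⟩
        map_add' := fun a b => by ext; simp [add_mul]
        map_smul' := fun a b => by ext; simp [smul_mul_assoc] }
    have hf : Function.Injective f := by
      intro a b hab
      have : a.1 * x = b.1 * x := congrArg Subtype.val hab
      exact Subtype.ext (mul_right_cancel₀ h0 this)
    obtain ⟨y, hy⟩ := (LinearMap.injective_iff_surjective.1 hf) ⟨1, hone⟩
    have : y.1 * x = 1 := congrArg Subtype.val hy
    rw [← eq_inv_of_mul_eq_one_left this]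
    exact y.2
  intro x hx
  induction hx using Subfield.closure_induction with
  | mem x hx =>
    rcases hx with hx | hx
    · have := S.smul_mem (⟨x, hx⟩ : M) hone
      change x * 1 ∈ S at this
      simpa using this
    · rw [Set.mem_singleton_iff] at hx
      have := hTS 1 hone
      rw [hx]; simpa using this
  | one => exact hone
  | add x y _ _ hx hy => exact S.add_mem hx hy
  | neg x _ hx => exact S.neg_mem hx
  | inv x _ hx => exact hinv x hx
  | mul x y _ _ hx hy => exact hmul x hx y hy

theorem aux_eigen {k Δ α : Type} [Field k] [DivisionRing Δ] (ι : k →+* Δ) (z : k) (w : α → k)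
    (hw : Function.Injective w) (S : Finset α) :
    ∀ (x : α → Δ), (∀ i ∈ S, x i * ι z = ι (w i) * x i) → ∑ i ∈ S, x i = 0 →
      ∀ i ∈ S, x i = 0 := by
  classical
  induction S using Finset.induction_on with
  | empty => simp
  | insert a S ha ih =>
    intro x hx hsum
    have h1 : (∑ i ∈ insert a S, x i) * ι z - ι (w a) * ∑ i ∈ insert a S, x i = 0 := by
      rw [hsum]; simp
    rw [Finset.sum_mul, Finset.mul_sum, ← Finset.sum_sub_distrib, Finset.sum_insert ha,
      hx a (Finset.mem_insert_self _ _), sub_self, zero_add] at h1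
    have h2 : ∑ i ∈ S, ι (w i - w a) * x i = 0 := by
      rw [← h1]
      refine Finset.sum_congr rfl fun i hi => ?_
      rw [hx i (Finset.mem_insert_of_mem hi), map_sub, sub_mul]
    have h3 := ih (fun i => ι (w i - w a) * x i) (by
      intro i hi
      rw [mul_assoc, hx i (Finset.mem_insert_of_mem hi), ← mul_assoc, ← mul_assoc, ← map_mul,
        ← map_mul, mul_comm]) h2
    have h4 : ∀ i ∈ S, x i = 0 := by
      intro i hi
      rcases mul_eq_zero.1 (h3 i hi) with h | h
      · rw [map_eq_zero, sub_eq_zero] at h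
        exact absurd (hw h ▸ hi) ha
      · exact h
    intro i hi
    rcases Finset.mem_insert.1 hi with rfl | hi
    · rwa [Finset.sum_insert ha, Finset.sum_eq_zero h4, add_zero] at hsum
    · exact h4 i hi

theorem aux_vander {k Δ : Type} [Field k] [DivisionRing Δ] (ι : k →+* Δ) {d : ℕ}
    (z : Fin d → k) (hz : Function.Injective z) (c : Fin d → Δ)
    (h : ∀ i, ∑ j, c j * ι (z i ^ (j : ℕ)) = 0) : ∀ j, c j = 0 := by
  classical
  intro j'
  set V := Matrix.vandermonde z with hV
  have hdet : IsUnit V.det := isUnit_iff_ne_zero.2 (Matrix.det_vandermonde_ne_zero_iff.2 hz)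
  have hVV : V⁻¹ * V = 1 := Matrix.nonsing_inv_mul V hdet
  have e : ∀ j, ∑ i, ι (V i j) * ι (V⁻¹ j' i) = if j' = j then 1 else 0 := by
    intro j
    have := congrFun (congrFun hVV j') j
    rw [Matrix.mul_apply, Matrix.one_apply] at this
    have := congrArg ι this
    rw [map_sum] at this
    calc _ = ∑ i, ι (V⁻¹ j' i * V i j) :=
          Finset.sum_congr rfl fun i _ => by rw [← map_mul, mul_comm]
      _ = _ := by rw [this]; split_ifs <;> simp
  have h0 : ∑ i, (∑ j, c j * ι (V i j)) * ι (V⁻¹ j' i) = 0 := by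
    refine Finset.sum_eq_zero fun i _ => ?_
    have := h i
    simp only [hV, Matrix.vandermonde_apply]
    rw [this, zero_mul]
  simp only [Finset.sum_mul, mul_assoc] at h0
  rw [Finset.sum_comm] at h0
  simp only [← Finset.mul_sum, e] at h0
  simpa using h0

theorem aux_prim {k : Type} [Field k] [Fintype k] {q n m : ℕ} (hq : 1 < q) (hn : 0 < n)
    (hk : Fintype.card k = q ^ n) (hmn : m ∣ n) : ∃ θ : k, IsPrimitiveRoot θ (q ^ m - 1) := by
  classical
  obtain ⟨γ, hγ⟩ := IsCyclic.exists_generator (α := kˣ)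
  have h1 : orderOf γ = q ^ n - 1 := by
    rw [orderOf_eq_card_of_forall_mem_zpowers hγ, Nat.card_units, Nat.card_eq_fintype_card, hk]
  have h2 : IsPrimitiveRoot γ (q ^ n - 1) := h1 ▸ IsPrimitiveRoot.orderOf γ
  have h2' : IsPrimitiveRoot (γ : k) (q ^ n - 1) := IsPrimitiveRoot.coe_units_iff.2 h2
  obtain ⟨c, hc⟩ : q ^ m - 1 ∣ q ^ n - 1 := by
    obtain ⟨e, rfl⟩ := hmn
    rw [pow_mul]
    simpa using Nat.sub_dvd_pow_sub_pow (q ^ m) 1 e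
  have : 0 < q ^ n - 1 := by
    have := Nat.one_lt_pow hn.ne' hq
    omega
  exact ⟨γ ^ c, h2'.pow this (by rw [hc, mul_comm])⟩

theorem aux_prim_inj {k : Type} [Field k] {q m : ℕ} (hq : 1 < q) {θ : k}
    (hθ : IsPrimitiveRoot θ (q ^ m - 1)) {a b : ℕ} (ha : a < m) (hb : b < m)
    (h : θ ^ q ^ a = θ ^ q ^ b) : a = b := by
  by_contra hab
  have hm : 2 ≤ m := by omega
  have key : ∀ a < m, q ^ a < q ^ m - 1 := by
    intro a ha
    have h1 : q ^ a ≤ q ^ (m - 1) := Nat.pow_le_pow_right (by omega) (by omega)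
    have h2 : q ^ m = q ^ (m - 1) * q := by rw [← pow_succ]; congr 1; omega
    have h3 : 1 < q ^ (m - 1) := Nat.one_lt_pow (by omega) hq
    have : q ^ (m - 1) * 2 ≤ q ^ (m - 1) * q := Nat.mul_le_mul_left _ hq
    omega
  exact hab (Nat.pow_right_injective hq (hθ.pow_inj (key a ha) (key b hb) h))

theorem aux_prim_fix {k : Type} [Field k] {q m : ℕ} (hq : 1 < q) {θ : k}
    (hθ : IsPrimitiveRoot θ (q ^ m - 1)) : θ ^ q ^ m = θ := by
  have h1 : 0 < q ^ m := by positivity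
  have h2 : q ^ m = (q ^ m - 1) + 1 := by omega
  rw [h2, pow_succ, hθ.pow_eq_one, one_mul]

theorem aux_fix_iterate {k : Type} [Field k] {q m : ℕ} {a : k}
    (h : a ^ q ^ m = a) (e : ℕ) : a ^ q ^ (m * e) = a := by
  induction e with
  | zero => simp
  | succ e ih => rw [mul_add, pow_add, pow_mul, ih, mul_one, h]

theorem aux_prim_dvd {k : Type} [Field k] {q m : ℕ} (hq : 1 < q) (hm : 0 < m) {θ : k}
    (hθ : IsPrimitiveRoot θ (q ^ m - 1)) {i : ℕ} (h : θ ^ q ^ i = θ) : m ∣ i := by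
  have h1 : θ ^ q ^ i = θ ^ q ^ (i % m) := by
    conv_lhs => rw [← Nat.div_add_mod i m, pow_add, pow_mul,
      aux_fix_iterate (aux_prim_fix hq hθ)]
  have h2 : θ ^ q ^ (i % m) = θ ^ q ^ 0 := by rw [← h1, h]; simp
  exact Nat.dvd_of_mod_eq_zero (aux_prim_inj hq hθ (Nat.mod_lt _ hm) hm h2)

theorem aux_card {k : Type} [Field k] [Fintype k] {q m : ℕ} (hq : 1 < q) (hm : 0 < m) {θ : k}
    (hθ : IsPrimitiveRoot θ (q ^ m - 1)) : Nat.card {a : k // a ^ q ^ m = a} = q ^ m := by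
  classical
  have h1 : 1 < q ^ m := Nat.one_lt_pow hm.ne' hq
  have h2 : q ^ m = (q ^ m - 1) + 1 := by omega
  have h3 : (Finset.univ.filter fun a : k => a ^ q ^ m = a) =
      insert 0 (Polynomial.nthRootsFinset (q ^ m - 1) (1 : k)) := by
    ext a
    rw [Finset.mem_insert, Polynomial.mem_nthRootsFinset (by omega)]
    simp only [Finset.mem_filter, Finset.mem_univ, true_and]
    by_cases ha : a = 0
    · simp [ha]; omega
    · rw [h2, pow_succ]
      simp [ha]
  rw [Nat.card_eq_fintype_card, Fintype.card_subtype, h3, Finset.card_insert_of_notMem,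
    hθ.card_nthRootsFinset]
  · omega
  · rw [Polynomial.mem_nthRootsFinset (by omega)]
    rw [zero_pow (by omega)]; simp

theorem aux_frob {k : Type} [Field k] {q : ℕ} (hq : 1 < q)
    (hadd : ∀ a b : k, (a + b) ^ q = a ^ q + b ^ q) (i : ℕ) :
    ∃ f : k →+* k, ∀ a, f a = a ^ q ^ i := by
  let f : k →+* k :=
    { toFun := fun a => a ^ q
      map_one' := one_pow q
      map_mul' := fun a b => mul_pow a b q
      map_zero' := zero_pow (by omega)
      map_add' := hadd }
  refine ⟨f ^ i, fun a => ?_⟩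
  induction i generalizing a with
  | zero => simp
  | succ i ih =>
    rw [pow_succ, RingHom.mul_def, RingHom.comp_apply, ih]
    change (a ^ q) ^ q ^ i = _
    rw [← pow_mul, pow_succ']

theorem aux_zinj {k : Type} [Field k] {q g m : ℕ} (hq : 1 < q) (hg : 0 < g) {θ : k}
    (hθ : IsPrimitiveRoot θ (q ^ m - 1)) :
    Function.Injective fun i : Fin (m / g) => θ ^ q ^ (g * (i : ℕ)) := by
  intro a b hab
  have key : ∀ a : Fin (m / g), g * (a : ℕ) < m := fun a => by
    have h1 := (Nat.lt_div_iff_mul_lt hg).1 a.2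
    have h2 : a.1 < m / g := a.2
    have := Nat.mul_div_le m g
    calc g * (a : ℕ) < g * (m / g) := Nat.mul_lt_mul_of_pos_left h2 hg
      _ ≤ m := this
  have := aux_prim_inj hq hθ (key a) (key b) hab
  exact Fin.ext (Nat.eq_of_mul_eq_mul_left hg this)

theorem aux_surj {k : Type} [Field k] [Fintype k] {q g m : ℕ} (hq : 1 < q)
    (hadd : ∀ a b : k, (a + b) ^ q = a ^ q + b ^ q) (hg : 0 < g) (hm : 0 < m) (hgm : g ∣ m)
    {θ η : k} (hθ : IsPrimitiveRoot θ (q ^ m - 1)) (hη : IsPrimitiveRoot η (q ^ g - 1))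
    (a : k) (ha : a ^ q ^ m = a) :
    ∃ c : Fin (m / g) → k, (∀ j, c j ^ q ^ g = c j) ∧ a = ∑ j, c j * θ ^ (j : ℕ) := by
  classical
  obtain ⟨fm, hfm⟩ := aux_frob hq hadd m
  have hcm : ∀ x : k, x ^ q ^ g = x → x ^ q ^ m = x := by
    intro x hx
    obtain ⟨e, rfl⟩ := hgm
    exact aux_fix_iterate hx e
  let F : (Fin (m / g) → {a : k // a ^ q ^ g = a}) → {a : k // a ^ q ^ m = a} := fun c =>
    ⟨∑ j, (c j).1 * θ ^ (j : ℕ), by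
      rw [← hfm, map_sum]
      refine Finset.sum_congr rfl fun j _ => ?_
      rw [map_mul, map_pow, hfm, hfm, hcm _ (c j).2, aux_prim_fix hq hθ]⟩
  have hF : Function.Injective F := by
    intro c c' hcc
    have h0 : ∑ j, ((c j).1 - (c' j).1) * θ ^ (j : ℕ) = 0 := by
      have : ∑ j, (c j).1 * θ ^ (j : ℕ) = ∑ j, (c' j).1 * θ ^ (j : ℕ) :=
        congrArg Subtype.val hcc
      simp only [sub_mul, Finset.sum_sub_distrib, this, sub_self]
    have := aux_vander (RingHom.id k) _ (aux_zinj hq hg hθ) (fun j => (c j).1 - (c' j).1) (by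
      intro i
      obtain ⟨f, hf⟩ := aux_frob hq hadd (g * (i : ℕ))
      have h1 := congrArg f h0
      rw [map_sum, map_zero] at h1
      rw [← h1]
      refine Finset.sum_congr rfl fun j _ => ?_
      rw [map_mul, map_sub, map_pow f, hf, hf, hf, aux_fix_iterate (c j).2,
        aux_fix_iterate (c' j).2, RingHom.id_apply])
    funext j
    exact Subtype.ext (sub_eq_zero.1 (this j))
  have hbij := hF.bijective_of_nat_card_le (by
    rw [aux_card hq hm hθ, Nat.card_fun, aux_card hq hg hη, Nat.card_fin, ← pow_mul,
      Nat.mul_div_cancel' hgm])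
  obtain ⟨c, hc⟩ := hbij.2 ⟨a, ha⟩
  exact ⟨fun j => (c j).1, fun j => (c j).2, (congrArg Subtype.val hc).symm⟩

section main

variable {q n : ℕ} {k Δ : Type} [Field k] [Fintype k] [DivisionRing Δ]

theorem aux_add (hq : 1 < q) (ι : k →+* Δ) {τ : Δ} (hτ : τ ≠ 0)
    (hcomm : ∀ a : k, τ * ι a = ι (a ^ q) * τ) (a b : k) :
    (a + b) ^ q = a ^ q + b ^ q := by
  apply ι.injective
  apply mul_right_cancel₀ hτ
  rw [← hcomm, map_add, map_add, mul_add, add_mul, hcomm, hcomm]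

theorem aux_pow_comm (ι : k →+* Δ) {τ : Δ}
    (hcomm : ∀ a : k, τ * ι a = ι (a ^ q) * τ) (i : ℕ) (a : k) :
    τ ^ i * ι a = ι (a ^ q ^ i) * τ ^ i := by
  induction i generalizing a with
  | zero => simp
  | succ i ih =>
    rw [pow_succ, mul_assoc, hcomm, ← mul_assoc, ih, mul_assoc, ← pow_succ, ← pow_mul,
      ← pow_succ']

/-- `L_m = F_{q^m}(τ^n)` -/
def LL (q n : ℕ) (ι : k →+* Δ) (τ : Δ) (m : ℕ) : Subfield Δ :=
  Subfield.closure ((ι '' {a : k | a ^ q ^ m = a}) ∪ {τ ^ n})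

theorem LL_iota (ι : k →+* Δ) (τ : Δ) {m : ℕ} {a : k} (ha : a ^ q ^ m = a) :
    ι a ∈ LL q n ι τ m := Subfield.subset_closure (Or.inl ⟨a, ha, rfl⟩)

theorem LL_pi (ι : k →+* Δ) (τ : Δ) (m : ℕ) :
    τ ^ n ∈ LL q n ι τ m := Subfield.subset_closure (Or.inr rfl)

theorem LL_mono (ι : k →+* Δ) (τ : Δ) {g m : ℕ} (h : g ∣ m) :
    LL q n ι τ g ≤ LL q n ι τ m := by
  refine Subfield.closure_le.2 ?_
  rintro x (⟨a, ha, rfl⟩ | hx)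
  · obtain ⟨e, rfl⟩ := h
    exact LL_iota ι τ (aux_fix_iterate ha e)
  · rw [Set.mem_singleton_iff.1 hx]; exact LL_pi ι τ m

theorem LL_comm_iota (hk : Fintype.card k = q ^ n) (ι : k →+* Δ) {τ : Δ}
    (hcomm : ∀ a : k, τ * ι a = ι (a ^ q) * τ) {m : ℕ} {x : Δ} (hx : x ∈ LL q n ι τ m) (a : k) :
    x * ι a = ι a * x := by
  refine aux_comm_closure (B := {ι a}) ?_ x hx _ (Subfield.subset_closure rfl)
  rintro x (⟨b, -, rfl⟩ | hx) y hy
  · rw [Set.mem_singleton_iff.1 hy, ← map_mul, mul_comm, map_mul]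
  · rw [Set.mem_singleton_iff.1 hy, Set.mem_singleton_iff.1 hx, aux_pow_comm ι hcomm, ← hk,
      FiniteField.pow_card]

theorem LL_comm_tau (ι : k →+* Δ) {τ : Δ}
    (hcomm : ∀ a : k, τ * ι a = ι (a ^ q) * τ) {m : ℕ} {x : Δ} (hx : x ∈ LL q n ι τ m) (e : ℕ) :
    x * τ ^ (m * e) = τ ^ (m * e) * x := by
  refine aux_comm_closure (B := {τ ^ (m * e)}) ?_ x hx _ (Subfield.subset_closure rfl)
  rintro x (⟨b, hb, rfl⟩ | hx) y hy
  · rw [Set.mem_singleton_iff.1 hy, aux_pow_comm ι hcomm, aux_fix_iterate hb]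
  · rw [Set.mem_singleton_iff.1 hy, Set.mem_singleton_iff.1 hx, ← pow_add, ← pow_add, add_comm]

theorem LL_conj (ι : k →+* Δ) {τ : Δ} (hτ : τ ≠ 0)
    (hcomm : ∀ a : k, τ * ι a = ι (a ^ q) * τ) {m : ℕ} (t : ℕ) {x : Δ} (hx : x ∈ LL q n ι τ m) :
    ∃ y ∈ LL q n ι τ m, τ ^ t * x = y * τ ^ t := by
  have ht : τ ^ t ≠ 0 := pow_ne_zero _ hτ
  refine ⟨τ ^ t * x * (τ ^ t)⁻¹, aux_conj_closure _ ht ?_ x hx, by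
    rw [mul_assoc _ _ (τ ^ t), inv_mul_cancel₀ ht, mul_one]⟩
  rintro x (⟨b, hb, rfl⟩ | hx)
  · rw [aux_pow_comm ι hcomm, mul_assoc, mul_inv_cancel₀ ht, mul_one]
    refine LL_iota ι τ ?_
    rw [← pow_mul, mul_comm, pow_mul, hb]
  · rw [Set.mem_singleton_iff.1 hx, ← pow_add, add_comm, pow_add, mul_assoc,
      mul_inv_cancel₀ ht, mul_one]
    exact LL_pi ι τ m

/-- `D(m,t)` is spanned over `L_m` by powers of `τ^t`. -/
theorem D_span (hn : 0 < n) (ι : k →+* Δ) {τ : Δ} (hτ : τ ≠ 0)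
    (hcomm : ∀ a : k, τ * ι a = ι (a ^ q) * τ) (m t : ℕ) (ht : t ∣ n) {x : Δ}
    (hx : x ∈ Subfield.closure ((ι '' {a : k | a ^ q ^ m = a}) ∪ {τ ^ t})) :
    ∃ c : Fin (n / t) → Δ, (∀ i, c i ∈ LL q n ι τ m) ∧ x = ∑ i, c i * τ ^ (t * (i : ℕ)) := by
  have hd : 0 < n / t := Nat.div_pos (Nat.le_of_dvd hn ht) (Nat.pos_of_dvd_of_pos ht hn)
  have := aux_span (LL q n ι τ m) (τ ^ t) (n / t) hd (fun y hy => LL_conj ι hτ hcomm t hy)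
    (by
      rw [← pow_mul, Nat.mul_div_cancel' ht]
      have := Submodule.smul_mem (Submodule.span (LL q n ι τ m)
        (Set.range fun i : Fin (n / t) => (τ ^ t) ^ (i : ℕ)))
        (⟨τ ^ n, LL_pi ι τ m⟩ : LL q n ι τ m)
        (Submodule.subset_span ⟨(⟨0, hd⟩ : Fin (n / t)), rfl⟩)
      change τ ^ n * (τ ^ t) ^ 0 ∈ _ at this
      simpa using this) x
    (by
      refine Subfield.closure_mono ?_ hx
      exact Set.union_subset_union_left _ fun y ⟨a, ha, e⟩ => e ▸ LL_iota ι τ ha)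
  obtain ⟨c, hc⟩ := (Submodule.mem_span_range_iff_exists_fun _).1 this
  refine ⟨fun i => (c i : Δ), fun i => (c i).2, ?_⟩
  rw [← hc]
  refine Finset.sum_congr rfl fun i _ => ?_
  rw [pow_mul]; rfl

/-- `L_m` is spanned over `L_g` by powers of `θ`. -/
theorem LL_span (hq : 1 < q) (hk : Fintype.card k = q ^ n) (ι : k →+* Δ) {τ : Δ} (hτ : τ ≠ 0)
    (hcomm : ∀ a : k, τ * ι a = ι (a ^ q) * τ) {g m : ℕ} (hg : 0 < g) (hm : 0 < m) (hgm : g ∣ m)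
    {θ η : k} (hθ : IsPrimitiveRoot θ (q ^ m - 1)) (hη : IsPrimitiveRoot η (q ^ g - 1)) {x : Δ}
    (hx : x ∈ LL q n ι τ m) :
    ∃ c : Fin (m / g) → Δ, (∀ i, c i ∈ LL q n ι τ g) ∧ x = ∑ i, c i * ι (θ ^ (i : ℕ)) := by
  have hd : 0 < m / g := Nat.div_pos (Nat.le_of_dvd hm hgm) hg
  have hF : ∀ a : k, a ^ q ^ m = a → ι a ∈ Submodule.span (LL q n ι τ g)
      (Set.range fun i : Fin (m / g) => ι θ ^ (i : ℕ)) := by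
    intro a ha
    obtain ⟨c, hc, rfl⟩ := aux_surj hq (aux_add hq ι hτ hcomm) hg hm hgm hθ hη a ha
    rw [map_sum]
    refine Submodule.sum_mem _ fun j _ => ?_
    rw [map_mul, map_pow]
    exact Submodule.smul_mem _ (⟨ι (c j), LL_iota ι τ (hc j)⟩ : LL q n ι τ g)
      (Submodule.subset_span ⟨j, rfl⟩)
  have hθm := aux_prim_fix hq hθ
  have hxc : x ∈ Subfield.closure ((LL q n ι τ g : Set Δ) ∪ {ι θ}) := by
    suffices hle : LL q n ι τ m ≤ Subfield.closure ((LL q n ι τ g : Set Δ) ∪ {ι θ}) from hle hx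
    refine Subfield.closure_le.2 ?_
    rintro y (⟨a, ha, rfl⟩ | hy)
    · obtain ⟨c, hc, rfl⟩ := aux_surj hq (aux_add hq ι hτ hcomm) hg hm hgm hθ hη a ha
      rw [map_sum]
      refine sum_mem fun j _ => ?_
      rw [map_mul, map_pow]
      exact mul_mem (Subfield.subset_closure (Or.inl (LL_iota ι τ (hc j))))
        (pow_mem (Subfield.subset_closure (Set.mem_union_right _ (Set.mem_singleton _))) _)
    · rw [Set.mem_singleton_iff.1 hy]
      exact Subfield.subset_closure (Or.inl (LL_pi ι τ g))
  have := aux_span (LL q n ι τ g) (ι θ) (m / g) hd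
    (fun y hy => ⟨y, hy, (LL_comm_iota hk ι hcomm hy θ).symm⟩)
    (by
      rw [← map_pow]
      apply hF
      rw [← pow_mul, mul_comm, pow_mul, hθm]) x hxc
  obtain ⟨c, hc⟩ := (Submodule.mem_span_range_iff_exists_fun _).1 this
  refine ⟨fun i => (c i : Δ), fun i => (c i).2, ?_⟩
  rw [← hc]
  refine Finset.sum_congr rfl fun i _ => ?_
  rw [map_pow]; rfl

/-- independence of powers of `τ` over `L_m` -/
theorem tau_indep (hq : 1 < q) (hn : 0 < n) (hk : Fintype.card k = q ^ n) (ι : k →+* Δ) {τ : Δ}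
    (hτ : τ ≠ 0) (hcomm : ∀ a : k, τ * ι a = ι (a ^ q) * τ) {t : ℕ} (ht : t ∣ n)
    (c : Fin (n / t) → Δ) (m : ℕ) (hc : ∀ i, c i ∈ LL q n ι τ m)
    (h : ∑ i, c i * τ ^ (t * (i : ℕ)) = 0) : ∀ i, c i = 0 := by
  obtain ⟨θ, hθ⟩ := aux_prim hq hn hk dvd_rfl
  have ht0 : 0 < t := Nat.pos_of_dvd_of_pos ht hn
  intro i
  have := aux_eigen ι θ _ (aux_zinj hq ht0 hθ) Finset.univ
    (fun i => c i * τ ^ (t * (i : ℕ))) (by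
      intro i _
      rw [mul_assoc, aux_pow_comm ι hcomm, ← mul_assoc, LL_comm_iota hk ι hcomm (hc i),
        mul_assoc]) h i (Finset.mem_univ _)
  exact (mul_eq_zero.1 this).resolve_right (pow_ne_zero _ hτ)

theorem conj_sum (ι : k →+* Δ) {τ : Δ}
    (hcomm : ∀ a : k, τ * ι a = ι (a ^ q) * τ) {g d : ℕ} {θ : k}
    (c : Fin d → Δ) (hc : ∀ i, c i ∈ LL q n ι τ g) (i : ℕ) :
    τ ^ (g * i) * ∑ j, c j * ι (θ ^ (j : ℕ)) =
      (∑ j, c j * ι ((θ ^ q ^ (g * i)) ^ (j : ℕ))) * τ ^ (g * i) := by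
  rw [Finset.mul_sum, Finset.sum_mul]
  refine Finset.sum_congr rfl fun j _ => ?_
  rw [← mul_assoc, ← LL_comm_tau ι hcomm (hc j), mul_assoc, aux_pow_comm ι hcomm, ← mul_assoc,
    ← pow_mul, ← pow_mul, mul_comm (j : ℕ)]

theorem theta_indep (hq : 1 < q) (ι : k →+* Δ) {τ : Δ}
    (hτ : τ ≠ 0) (hcomm : ∀ a : k, τ * ι a = ι (a ^ q) * τ) {g m : ℕ} (hg : 0 < g)
    {θ : k} (hθ : IsPrimitiveRoot θ (q ^ m - 1))
    (c : Fin (m / g) → Δ) (hc : ∀ i, c i ∈ LL q n ι τ g)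
    (h : ∑ i, c i * ι (θ ^ (i : ℕ)) = 0) : ∀ i, c i = 0 := by
  refine aux_vander ι _ (aux_zinj hq hg hθ) c fun i => ?_
  have := conj_sum (θ := θ) ι hcomm c hc i
  rw [h, mul_zero] at this
  exact (mul_eq_zero.1 this.symm).resolve_right (pow_ne_zero _ hτ)

theorem LL_fixed (hq : 1 < q) (hn : 0 < n) (hk : Fintype.card k = q ^ n) (ι : k →+* Δ) {τ : Δ}
    (hτ : τ ≠ 0) (hcomm : ∀ a : k, τ * ι a = ι (a ^ q) * τ) {s : ℕ} (hs : s ∣ n) {x : Δ}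
    (hx : x ∈ LL q n ι τ n) (h : τ ^ s * x = x * τ ^ s) : x ∈ LL q n ι τ s := by
  obtain ⟨θ, hθ⟩ := aux_prim hq hn hk dvd_rfl
  obtain ⟨η, hη⟩ := aux_prim hq hn hk hs
  have hs0 : 0 < s := Nat.pos_of_dvd_of_pos hs hn
  have hd : 0 < n / s := Nat.div_pos (Nat.le_of_dvd hn hs) hs0
  obtain ⟨c, hc, e⟩ := LL_span hq hk ι hτ hcomm hs0 hn hs hθ hη hx
  let j0 : Fin (n / s) := ⟨0, hd⟩
  have key := aux_vander ι _ (aux_zinj hq hs0 hθ) (fun j => c j - if j = j0 then x else 0) (by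
    intro i
    have h1 := conj_sum (θ := θ) ι hcomm c hc i
    have h2 : τ ^ (s * (i : ℕ)) * x = x * τ ^ (s * (i : ℕ)) := by
      rw [pow_mul]
      exact Commute.pow_left (show Commute (τ ^ s) x from h) i
    rw [← e, h2] at h1
    have h3 := mul_right_cancel₀ (pow_ne_zero _ hτ) h1
    simp only [sub_mul, Finset.sum_sub_distrib, ite_mul, zero_mul, Finset.sum_ite_eq',
      Finset.mem_univ, if_true]
    rw [← h3]
    simp [j0]) j0
  simp only [if_true] at key
  rw [← sub_eq_zero.1 key]
  exact hc j0

end main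

/-- **Centralizer of `Δ(ℓ,s)` and its dimension over `K_g`.**
With `n = lcm(ℓ,s)`, `g = gcd(ℓ,s)`, `Δ = k(τ)` the central division algebra over
`K = F_q(π)` (`π = τ^n`), `Δ(ℓ,s) = F_{q^ℓ}(τ^s)` and `Δ(s,ℓ) = F_{q^s}(τ^ℓ)`:
the centralizer of `Δ(ℓ,s)` in `Δ` equals `Δ(s,ℓ)`, and
`dim_{K_g} Δ(ℓ,s) = (ℓ/g)²` where `K_g = F_{q^g}(π)`.
(The dimension is stated as the `K_g`-rank of the `K_g`-span of `Δ(ℓ,s)` in `Δ`.) -/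
theorem centralizer_of_Delta_ls
    {q ℓ s n g : ℕ} (hq : 1 < q) (hℓ : 0 < ℓ) (hs : 0 < s)
    (hn : n = Nat.lcm ℓ s) (hg : g = Nat.gcd ℓ s)
    {k Δ : Type} [Field k] [Fintype k] (hk : Fintype.card k = q ^ n)
    [DivisionRing Δ] (ι : k →+* Δ) (τ : Δ) (hτ : τ ≠ 0)
    (hcomm : ∀ a : k, τ * ι a = ι (a ^ q) * τ)
    (hgen : Subfield.closure (Set.range ι ∪ {τ}) = ⊤)
    (hZ : (Subring.center Δ : Set Δ) =
      ↑(Subfield.closure ((ι '' {a : k | a ^ q = a}) ∪ {τ ^ n}))) :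
    {x : Δ | ∀ y ∈ Subfield.closure ((ι '' {a : k | a ^ q ^ ℓ = a}) ∪ {τ ^ s}), y * x = x * y} =
      ↑(Subfield.closure ((ι '' {a : k | a ^ q ^ s = a}) ∪ {τ ^ ℓ})) ∧
    Module.finrank ↥(Subfield.closure ((ι '' {a : k | a ^ q ^ g = a}) ∪ {τ ^ n}))
      ↥(Submodule.span ↥(Subfield.closure ((ι '' {a : k | a ^ q ^ g = a}) ∪ {τ ^ n}))
        ((Subfield.closure ((ι '' {a : k | a ^ q ^ ℓ = a}) ∪ {τ ^ s}) : Subfield Δ) : Set Δ)) =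
      (ℓ / g) ^ 2 := by
  have hℓn : ℓ ∣ n := hn ▸ Nat.dvd_lcm_left ℓ s
  have hsn : s ∣ n := hn ▸ Nat.dvd_lcm_right ℓ s
  have hgℓ : g ∣ ℓ := hg ▸ Nat.gcd_dvd_left ℓ s
  have hn0 : 0 < n := hn ▸ Nat.lcm_pos hℓ hs
  have hg0 : 0 < g := hg ▸ Nat.gcd_pos_of_pos_left s hℓ
  have hdiv : n / s = ℓ / g := by
    have h1 : g * n = ℓ * s := by rw [hg, hn]; exact Nat.gcd_mul_lcm ℓ s
    obtain ⟨a, ha⟩ := hsn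
    obtain ⟨b, hb⟩ := hgℓ
    rw [ha, hb, Nat.mul_div_cancel_left _ hs, Nat.mul_div_cancel_left _ hg0]
    rw [ha, hb] at h1
    have h2 : (g * s) * a = (g * s) * b := by linarith
    exact Nat.eq_of_mul_eq_mul_left (Nat.mul_pos hg0 hs) h2
  obtain ⟨θ, hθ⟩ := aux_prim hq hn0 hk hℓn
  obtain ⟨η, hη⟩ := aux_prim hq hn0 hk (hgℓ.trans hℓn)
  have hθfix := aux_prim_fix hq hθ
  constructor
  · ext x
    constructor
    · intro hx
      have hx1 : ι θ * x = x * ι θ := hx _ (Subfield.subset_closure (Or.inl ⟨θ, hθfix, rfl⟩))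
      have hx2 : τ ^ s * x = x * τ ^ s := hx _ (Subfield.subset_closure (Or.inr rfl))
      have hxt : x ∈ Subfield.closure ((ι '' {a : k | a ^ q ^ n = a}) ∪ {τ ^ 1}) := by
        have e : (ι '' {a : k | a ^ q ^ n = a}) = Set.range ι := by
          rw [← Set.image_univ]; congr 1; ext a
          simp [← hk, FiniteField.pow_card]
        rw [e, pow_one, hgen]; trivial
      obtain ⟨c, hc, e⟩ := D_span hn0 ι hτ hcomm n 1 (one_dvd n) hxt
      have h1 : ∀ i, c i * ι (θ ^ q ^ (1 * (i : ℕ)) - θ) = 0 := by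
        refine tau_indep hq hn0 hk ι hτ hcomm (one_dvd n) _ n (fun i => mul_mem (hc i)
          (LL_iota ι τ (by rw [← hk, FiniteField.pow_card]))) ?_
        have h2 : x * ι θ - ι θ * x = 0 := sub_eq_zero.2 hx1.symm
        rw [e, Finset.sum_mul, Finset.mul_sum, ← Finset.sum_sub_distrib] at h2
        rw [← h2]
        refine Finset.sum_congr rfl fun i _ => ?_
        rw [mul_assoc (c i) (τ ^ _), aux_pow_comm ι hcomm, ← mul_assoc, ← mul_assoc,
          ← LL_comm_iota hk ι hcomm (hc i) θ, map_sub, mul_sub, sub_mul]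
      have h3 : ∀ i, τ ^ s * c i = c i * τ ^ s := by
        choose y hy hyc using fun i => LL_conj ι hτ hcomm s (hc i)
        have h4 : ∀ i, y i - c i = 0 := by
          refine tau_indep hq hn0 hk ι hτ hcomm (one_dvd n) _ n
            (fun i => sub_mem (hy i) (hc i)) ?_
          have h2 : τ ^ s * x - x * τ ^ s = 0 := sub_eq_zero.2 hx2
          rw [e, Finset.sum_mul, Finset.mul_sum, ← Finset.sum_sub_distrib] at h2
          refine (mul_eq_zero.1 (?_ : _ * τ ^ s = 0)).resolve_right (pow_ne_zero _ hτ)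
          rw [← h2, Finset.sum_mul]
          refine Finset.sum_congr rfl fun i _ => ?_
          rw [← mul_assoc (τ ^ s), hyc, sub_mul, sub_mul, mul_assoc (y i), mul_assoc (y i),
            ← pow_add, ← pow_add, add_comm s]
        intro i
        rw [hyc, sub_eq_zero.1 (h4 i)]
      rw [e]
      refine sum_mem fun i _ => ?_
      rcases mul_eq_zero.1 (h1 i) with h | h
      · rw [h, zero_mul]; exact zero_mem _
      · rw [map_eq_zero, sub_eq_zero] at h
        obtain ⟨r, hr⟩ := aux_prim_dvd hq hℓ hθ h
        have hcs := LL_fixed hq hn0 hk ι hτ hcomm hsn (hc i) (h3 i)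
        have hτm : τ ^ ℓ ∈ Subfield.closure ((ι '' {a : k | a ^ q ^ s = a}) ∪ {τ ^ ℓ}) :=
          Subfield.subset_closure (Or.inr rfl)
        refine mul_mem ?_ ?_
        · refine (Subfield.closure_le.2 ?_ :
            LL q n ι τ s ≤ Subfield.closure ((ι '' {a : k | a ^ q ^ s = a}) ∪ {τ ^ ℓ})) hcs
          rintro y (hy | hy)
          · exact Subfield.subset_closure (Or.inl hy)
          · rw [Set.mem_singleton_iff.1 hy, ← Nat.mul_div_cancel' hℓn, pow_mul]
            exact pow_mem hτm _
        · rw [hr, pow_mul]; exact pow_mem hτm _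
    · intro hx y hy
      refine aux_comm_closure ?_ y hy x hx
      rintro a (⟨a, ha, rfl⟩ | ha) b (⟨b, hb, rfl⟩ | hb)
      · rw [← map_mul, mul_comm, map_mul]
      · rw [Set.mem_singleton_iff.1 hb, aux_pow_comm ι hcomm, show a ^ q ^ ℓ = a from ha]
      · rw [Set.mem_singleton_iff.1 ha, aux_pow_comm ι hcomm, show b ^ q ^ s = b from hb]
      · rw [Set.mem_singleton_iff.1 ha, Set.mem_singleton_iff.1 hb, ← pow_add, ← pow_add,
          add_comm]
  · change Module.finrank (LL q n ι τ g) (Submodule.span (LL q n ι τ g)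
      ((Subfield.closure ((ι '' {a : k | a ^ q ^ ℓ = a}) ∪ {τ ^ s}) : Subfield Δ) : Set Δ)) = _
    let b : Fin (n / s) × Fin (ℓ / g) → Δ := fun p =>
      ι (θ ^ (p.2 : ℕ)) * τ ^ (s * (p.1 : ℕ))
    have hb : LinearIndependent (LL q n ι τ g) b := by
      rw [Fintype.linearIndependent_iff]
      intro c h
      have hcL : ∀ p, (c p : Δ) ∈ LL q n ι τ g := fun p => (c p).2
      have h0 : ∑ i, (∑ j, (c (i, j) : Δ) * ι (θ ^ (j : ℕ))) * τ ^ (s * (i : ℕ)) = 0 := by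
        rw [← h, Fintype.sum_prod_type]
        refine Finset.sum_congr rfl fun i _ => ?_
        rw [Finset.sum_mul]
        refine Finset.sum_congr rfl fun j _ => ?_
        rw [mul_assoc]; rfl
      have h1 := tau_indep hq hn0 hk ι hτ hcomm hsn _ ℓ (fun i => sum_mem fun j _ =>
        mul_mem (LL_mono ι τ hgℓ (hcL (i, j))) (LL_iota ι τ (by
          rw [← pow_mul, mul_comm, pow_mul, hθfix]))) h0
      rintro ⟨i, j⟩
      exact Subtype.ext (theta_indep hq ι hτ hcomm hg0 hθ (fun j => (c (i, j) : Δ))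
        (fun j => hcL (i, j)) (h1 i) j)
    have hspan : Submodule.span (LL q n ι τ g)
        ((Subfield.closure ((ι '' {a : k | a ^ q ^ ℓ = a}) ∪ {τ ^ s}) : Subfield Δ) : Set Δ) =
        Submodule.span (LL q n ι τ g) (Set.range b) := by
      apply le_antisymm
      · refine Submodule.span_le.2 fun x hx => ?_
        obtain ⟨c, hc, e⟩ := D_span hn0 ι hτ hcomm ℓ s hsn hx
        rw [e]
        refine Submodule.sum_mem _ fun i _ => ?_
        obtain ⟨c', hc', e'⟩ := LL_span hq hk ι hτ hcomm hg0 hℓ hgℓ hθ hη (hc i)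
        rw [e', Finset.sum_mul]
        refine Submodule.sum_mem _ fun j _ => ?_
        rw [mul_assoc]
        exact Submodule.smul_mem _ (⟨c' j, hc' j⟩ : LL q n ι τ g)
          (Submodule.subset_span ⟨(i, j), rfl⟩)
      · refine Submodule.span_mono ?_
        rintro _ ⟨⟨i, j⟩, rfl⟩
        refine mul_mem ?_ ?_
        · exact Subfield.subset_closure (Or.inl ⟨_, by
            change (θ ^ (j : ℕ)) ^ q ^ ℓ = θ ^ (j : ℕ)
            rw [← pow_mul, mul_comm, pow_mul, hθfix], rfl⟩)
        · rw [pow_mul]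
          exact pow_mem (Subfield.subset_closure (Set.mem_union_right _ (Set.mem_singleton _))) _
    rw [hspan, finrank_span_eq_card hb, Fintype.card_prod, Fintype.card_fin, Fintype.card_fin,
      hdiv, sq]
end
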